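/- (Sprinkling step.) Let λ > λ_c and ε₁, ε₂ > 0 be fixed, and let p = p(n) satisfy λ n^{-1/2} ≤ p(n) ≤ 5 n^{-1/2} √(log n). Let H be a fixed graph on a vertex set V with n/2 ≤ |V| ≤ n such that at least ε₂ n² non-edges of H lie in square-components of □(H) of order at least M, where M satisfies (log n)⁴ ≤ M ≤ (ε₂/4) n². Let W be a set of ε₁ n / (2 log₂ n) vertices disjoint from V, and let Γ be the random graph on V ∪ W obtained from H by including each pair of vertices meeting W (both pairs inside W and pairs between V and W) independently as an edge with probability p, while keeping the edges inside V exactly those of H. Then for all n sufficiently large, with probability at least 1 − 2 exp( −ε₂ ε₁² (log n)² / 2^{16} ), at least ε₂ n² non-edges of Γ lie in square-components of □(Γ) of order at least 2M. -/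

import Mathlib

open MeasureTheory Filter

noncomputable section

/-- The critical constant `λ_c = √(√6 - 2)`. -/
def lambdaC : ℝ := Real.sqrt (Real.sqrt 6 - 2)

/-- The Bernoulli measure on `Bool` with success probability `p`. -/
def bernoulliBool (p : ℝ) : Measure Bool :=
  ENNReal.ofReal p • Measure.dirac true + ENNReal.ofReal (1 - p) • Measure.dirac false

/-- The Erdős–Rényi measure: each potential edge of a graph on `Fin n` is present
independently with probability `p`. -/
def erMeasure (n : ℕ) (p : ℝ) : Measure (Sym2 (Fin n) → Bool) :=
  Measure.pi fun _ => bernoulliBool p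

/-- The graph determined by a Boolean function on unordered pairs. -/
def graphOf {n : ℕ} (ω : Sym2 (Fin n) → Bool) : SimpleGraph (Fin n) :=
  SimpleGraph.fromRel fun x y => ω s(x, y) = true

/-- `e` is a non-edge of `Γ`: a pair of distinct non-adjacent vertices. -/
def IsNonEdge {V : Type*} (Γ : SimpleGraph V) (e : Sym2 V) : Prop :=
  ¬ e.IsDiag ∧ e ∉ Γ.edgeSet

/-- Two pairs are related if they are the diagonals of an induced 4-cycle of `Γ`. -/
def squareAdj {V : Type*} (Γ : SimpleGraph V) (e f : Sym2 V) : Prop :=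
  ∃ a b c d : V, e = s(a, c) ∧ f = s(b, d) ∧ a ≠ c ∧ b ≠ d ∧
    ¬ Γ.Adj a c ∧ ¬ Γ.Adj b d ∧ Γ.Adj a b ∧ Γ.Adj b c ∧ Γ.Adj c d ∧ Γ.Adj d a

/-- The square-graph `□(Γ)`: vertices are pairs (its relevant vertices being non-edges of
`Γ`), and edges join the two diagonals of each induced 4-cycle of `Γ`. -/
def squareGraph {V : Type*} (Γ : SimpleGraph V) : SimpleGraph (Sym2 V) :=
  SimpleGraph.fromRel (squareAdj Γ)

/-- The square-component of a pair `e`: its connected component in `□(Γ)`. -/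
def squareComponent {V : Type*} (Γ : SimpleGraph V) (e : Sym2 V) : Set (Sym2 V) :=
  {f | (squareGraph Γ).Reachable e f}

/-- The support of a collection of pairs: the union of the pairs. -/
def suppOf {V : Type*} (C : Set (Sym2 V)) : Set V :=
  {v | ∃ e ∈ C, v ∈ e}
/-- The random graph obtained from `H` on `Fin m` by adjoining `w` new vertices and
including each pair of vertices meeting the new set as an edge according to `ω` (in the
random model, independently with probability `p`), while keeping the edges inside
`Fin m` exactly those of `H`. -/
def sprinkleGraph (m w : ℕ) (H : SimpleGraph (Fin m))
    (ω : Sym2 (Fin m ⊕ Fin w) → Bool) : SimpleGraph (Fin m ⊕ Fin w) :=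
  SimpleGraph.fromRel fun x y =>
    match x, y with
    | Sum.inl a, Sum.inl b => H.Adj a b
    | _, _ => ω s(x, y) = true

/-- The product Bernoulli measure on pair-indicators for the sprinkled pairs.  (Only the
coordinates of pairs meeting the new vertex set are read by `sprinkleGraph`, so this
gives each such pair independently with probability `p`.) -/
def sprinkleMeasure (m w : ℕ) (p : ℝ) : Measure (Sym2 (Fin m ⊕ Fin w) → Bool) :=
  Measure.pi fun _ => bernoulliBool p


section Bernoulli

open ProbabilityTheory

variable {ι : Type*} {p : ℝ}

lemma isProbabilityMeasure_bernoulliBool (h0 : 0 ≤ p) (h1 : p ≤ 1) :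
    IsProbabilityMeasure (bernoulliBool p) := by
  constructor
  simp only [bernoulliBool, Measure.add_apply, Measure.smul_apply, measure_univ, smul_eq_mul,
    mul_one]
  rw [← ENNReal.ofReal_add h0 (by linarith)]
  simp

lemma bernoulliBool_real_singleton (h0 : 0 ≤ p) (h1 : p ≤ 1) (b : Bool) :
    (bernoulliBool p).real {b} = if b then p else 1 - p := by
  cases b <;>
    simp [Measure.real, bernoulliBool, ENNReal.toReal_ofReal h0,
      ENNReal.toReal_ofReal (sub_nonneg.2 h1)]

variable [Fintype ι]

lemma pi_bernoulliBool_cylinder (h0 : 0 ≤ p) (h1 : p ≤ 1) (S : Finset ι) (b : ι → Bool) :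
    (Measure.pi fun _ : ι => bernoulliBool p).real {ω | ∀ i ∈ S, ω i = b i} =
      ∏ i ∈ S, if b i then p else 1 - p := by
  classical
  have := isProbabilityMeasure_bernoulliBool h0 h1
  have hset : {ω : ι → Bool | ∀ i ∈ S, ω i = b i} =
      Set.univ.pi fun i => if i ∈ S then {b i} else Set.univ := by
    ext ω
    simp only [Set.mem_ofPred_eq, Set.mem_pi, Set.mem_univ, forall_const]
    refine forall_congr' fun i => ?_
    by_cases h : i ∈ S <;> simp [h]
  rw [hset, Measure.real, Measure.pi_pi, ENNReal.toReal_prod]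
  rw [← Finset.prod_subset (Finset.subset_univ S)]
  · refine Finset.prod_congr rfl fun i hi => ?_
    rw [if_pos hi]
    exact bernoulliBool_real_singleton h0 h1 (b i)
  · intro i _ hi
    rw [if_neg hi, measure_univ, ENNReal.toReal_one]

/-- Membership in `E` is determined by the coordinates in `S`. -/
def DeterminedBy (E : Set (ι → Bool)) (S : Finset ι) : Prop :=
  ∀ ω ω' : ι → Bool, (∀ i ∈ S, ω i = ω' i) → (ω ∈ E ↔ ω' ∈ E)

omit [Fintype ι] in
lemma DeterminedBy.compl {E : Set (ι → Bool)} {S : Finset ι} (h : DeterminedBy E S) :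
    DeterminedBy Eᶜ S := fun ω ω' hω => not_congr (h ω ω' hω)

lemma pi_bernoulliBool_inter (h0 : 0 ≤ p) (h1 : p ≤ 1) {S T : Finset ι} (hST : Disjoint S T)
    {E F : Set (ι → Bool)} (hE : DeterminedBy E S) (hF : DeterminedBy F T) :
    (Measure.pi fun _ : ι => bernoulliBool p).real (E ∩ F) =
      (Measure.pi fun _ : ι => bernoulliBool p).real E *
        (Measure.pi fun _ : ι => bernoulliBool p).real F := by
  classical
  have := isProbabilityMeasure_bernoulliBool h0 h1
  have hind : iIndepFun (fun (i : ι) (ω : ι → Bool) => ω i)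
      (Measure.pi fun _ : ι => bernoulliBool p) :=
    iIndepFun_pi (X := fun _ b => b) fun _ => aemeasurable_id
  have h := hind.indepFun_finset S T hST (fun i => measurable_pi_apply i)
  have key : ∀ {E : Set (ι → Bool)} {S : Finset ι}, DeterminedBy E S →
      E = (fun (ω : ι → Bool) (i : S) => ω i) ⁻¹' ((fun (ω : ι → Bool) (i : S) => ω i) '' E) := by
    intro E S hE
    refine Set.Subset.antisymm (Set.subset_preimage_image _ _) ?_
    rintro ω ⟨ω', hω', heq⟩
    exact (hE ω' ω fun i hi => congrFun heq ⟨i, hi⟩).1 hω'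
  have h2 := h.measure_inter_preimage_eq_mul ((fun (ω : ι → Bool) (i : S) => ω i) '' E)
    ((fun (ω : ι → Bool) (i : T) => ω i) '' F) (.of_discrete) (.of_discrete)
  rw [← key hE, ← key hF] at h2
  rw [Measure.real, h2, ENNReal.toReal_mul]
  rfl

lemma pi_bernoulliBool_biInter (h0 : 0 ≤ p) (h1 : p ≤ 1) {κ : Type*} (s : Finset κ)
    {S : κ → Finset ι} (hS : (s : Set κ).PairwiseDisjoint S) {E : κ → Set (ι → Bool)}
    (hE : ∀ j ∈ s, DeterminedBy (E j) (S j)) :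
    (Measure.pi fun _ : ι => bernoulliBool p).real (⋂ j ∈ s, E j) =
      ∏ j ∈ s, (Measure.pi fun _ : ι => bernoulliBool p).real (E j) := by
  classical
  have := isProbabilityMeasure_bernoulliBool h0 h1
  induction s using Finset.induction_on with
  | empty => simp
  | insert a s ha ih =>
    rw [Finset.set_biInter_insert, Finset.prod_insert ha,
      pi_bernoulliBool_inter (T := s.biUnion S) h0 h1 ?_ (hE a (Finset.mem_insert_self a s)),
      ih (hS.subset (by simp)) fun j hj => hE j (Finset.mem_insert_of_mem hj)]
    · intro ω ω' hω
      simp only [Set.mem_iInter]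
      refine forall₂_congr fun j hj => ?_
      exact hE j (Finset.mem_insert_of_mem hj) ω ω' fun i hi =>
        hω i (Finset.mem_biUnion.2 ⟨j, hj, hi⟩)
    · rw [Finset.disjoint_biUnion_right]
      intro j hj
      exact hS (by simp) (by simp [hj]) (by rintro rfl; exact ha hj)

end Bernoulli

/-- A second-moment lower bound for the probability of a union, with free parameter `t`. -/
lemma second_moment_union {Ω κ : Type*} [Fintype Ω] [MeasurableSpace Ω]
    [DiscreteMeasurableSpace Ω] (μ : Measure Ω) [IsProbabilityMeasure μ] (s : Finset κ)
    (E : κ → Set Ω) (t : ℝ) :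
    2 * t * ∑ i ∈ s, μ.real (E i) - t ^ 2 * ∑ i ∈ s, ∑ j ∈ s, μ.real (E i ∩ E j) ≤
      μ.real (⋃ i ∈ s, E i) := by
  classical
  have hind : ∀ F : Set Ω, μ.real F = ∫ ω, F.indicator (fun _ => (1 : ℝ)) ω ∂μ := fun F => by
    rw [integral_indicator .of_discrete]; simp
  simp only [hind]
  rw [← integral_finsetSum _ fun i _ => Integrable.of_finite]
  simp_rw [← integral_finsetSum s fun (_ : κ) _ => Integrable.of_finite]
  rw [← integral_const_mul, ← integral_const_mul,
    ← integral_sub Integrable.of_finite Integrable.of_finite]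
  refine integral_mono Integrable.of_finite Integrable.of_finite fun ω => ?_
  have hsq : ∑ i ∈ s, ∑ j ∈ s, (E i ∩ E j).indicator (fun _ => (1 : ℝ)) ω =
      (∑ i ∈ s, (E i).indicator (fun _ => (1 : ℝ)) ω) ^ 2 := by
    rw [sq, Finset.sum_mul_sum]
    refine Finset.sum_congr rfl fun i _ => Finset.sum_congr rfl fun j _ => ?_
    by_cases hi : ω ∈ E i <;> by_cases hj : ω ∈ E j <;> simp [hi, hj]
  by_cases hω : ω ∈ ⋃ i ∈ s, E i
  · simp only [hsq, Set.indicator_of_mem hω]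
    nlinarith [sq_nonneg (1 - t * ∑ i ∈ s, (E i).indicator (fun _ => (1 : ℝ)) ω)]
  · have h0 : ∑ i ∈ s, (E i).indicator (fun _ => (1 : ℝ)) ω = 0 := by
      refine Finset.sum_eq_zero fun i hi => Set.indicator_of_notMem ?_ _
      intro h
      exact hω (Set.mem_biUnion (Finset.mem_coe.2 hi) h)
    simp only [hsq, h0, Set.indicator_of_notMem hω]
    simp

section BallsBins

variable {W β : Type*} [Fintype W] [Fintype β] [DecidableEq W] [DecidableEq β]

/-- Independent balls land in bins with distributions `P x`; each bin of `T` is hit by a given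
ball with probability `r`. A bin of `T` hit by some ball contributes a factor `1 - q`. -/
lemma sum_prod_mul_pow_hit_le (P : W → β → ℝ) (hP0 : ∀ x o, 0 ≤ P x o)
    (hP1 : ∀ x, ∑ o, P x o = 1) (T : Finset β) {r q : ℝ} (hr1 : r ≤ 1)
    (hr : ∀ x, ∀ f ∈ T, P x f = r) (hq0 : 0 ≤ q) (hq1 : q ≤ 1) :
    ∑ l : W → β, (∏ x, P x (l x)) * (1 - q) ^ (T.filter fun f => ∃ x, l x = f).card ≤
      (1 - q * (1 - (1 - r) ^ Fintype.card W)) ^ T.card := by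
  have hexp : ∀ l : W → β, (1 - q) ^ (T.filter fun f => ∃ x, l x = f).card =
      ∑ F ∈ T.powerset, q ^ F.card * (1 - q) ^ (T.card - F.card) *
        (if ∀ x, l x ∉ F then 1 else 0) := by
    intro l
    have h1 : (1 - q) ^ (T.filter fun f => ∃ x, l x = f).card =
        ∏ f ∈ T, ((if ∃ x, l x = f then 0 else q) + (1 - q)) := by
      rw [← Finset.prod_const, Finset.prod_filter]
      refine Finset.prod_congr rfl fun f _ => ?_
      split_ifs <;> ring
    rw [h1, Finset.prod_add]
    refine Finset.sum_congr rfl fun F hF => ?_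
    rw [Finset.prod_const, Finset.card_sdiff_of_subset (Finset.mem_powerset.1 hF)]
    split_ifs with h
    · rw [Finset.prod_congr rfl (g := fun _ => q), Finset.prod_const, mul_one]
      intro f hf
      rw [if_neg]
      rintro ⟨x, rfl⟩
      exact h x hf
    · push Not at h
      obtain ⟨x, hx⟩ := h
      have h0 : ∏ f ∈ F, (if ∃ x, l x = f then 0 else q) = 0 :=
        Finset.prod_eq_zero hx (if_pos ⟨x, rfl⟩)
      rw [h0]
      ring
  have hempty : ∀ F ∈ T.powerset,
      ∑ l : W → β, (∏ x, P x (l x)) * (if ∀ x, l x ∉ F then (1 : ℝ) else 0) ≤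
        ((1 - r) ^ Fintype.card W) ^ F.card := by
    intro F hF
    have h1 : ∀ l : W → β, (∏ x, P x (l x)) * (if ∀ x, l x ∉ F then (1 : ℝ) else 0) =
        ∏ x, (if l x ∉ F then P x (l x) else 0) := by
      intro l
      split_ifs with h
      · rw [mul_one]
        exact Finset.prod_congr rfl fun x _ => (if_pos (h x)).symm
      · push Not at h
        obtain ⟨x, hx⟩ := h
        rw [mul_zero, Finset.prod_eq_zero (Finset.mem_univ x)]
        simp [hx]
    simp_rw [h1]
    have h2 := Finset.prod_univ_sum (fun _ : W => (Finset.univ : Finset β))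
      (fun x o => if o ∉ F then P x o else 0)
    rw [Fintype.piFinset_univ] at h2
    rw [← h2, ← pow_mul, mul_comm, pow_mul]
    have h3 : ∀ x, ∑ o, (if o ∉ F then P x o else 0) = 1 - F.card * r := by
      intro x
      rw [← Finset.sum_filter, ← hP1 x, eq_sub_iff_add_eq]
      have : (F.card : ℝ) * r = ∑ o ∈ Finset.univ.filter (· ∈ F), P x o := by
        rw [Finset.filter_univ_mem, Finset.sum_congr rfl fun f hf =>
          hr x f (Finset.mem_powerset.1 hF hf)]
        simp
      rw [this, add_comm]
      exact Finset.sum_filter_add_sum_filter_not _ _ _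
    have h4 : ∏ x, ∑ o, (if o ∉ F then P x o else 0) ≤ ∏ _x : W, (1 - r) ^ F.card := by
      refine Finset.prod_le_prod (fun x _ => Finset.sum_nonneg fun o _ => ?_) fun x _ => ?_
      · split_ifs
        exacts [le_rfl, hP0 x o]
      · rw [h3 x]
        have := one_add_mul_le_pow (a := -r) (by linarith) F.card
        rw [← sub_eq_add_neg] at this
        linarith
    refine h4.trans ?_
    rw [Finset.prod_const, Finset.card_univ]
  simp_rw [hexp, Finset.mul_sum]
  rw [Finset.sum_comm]
  calc _ = ∑ F ∈ T.powerset, q ^ F.card * (1 - q) ^ (T.card - F.card) *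
        ∑ l : W → β, (∏ x, P x (l x)) * (if ∀ x, l x ∉ F then (1 : ℝ) else 0) := by
        refine Finset.sum_congr rfl fun F _ => ?_
        rw [Finset.mul_sum]
        refine Finset.sum_congr rfl fun l _ => ?_
        ring
    _ ≤ ∑ F ∈ T.powerset, q ^ F.card * (1 - q) ^ (T.card - F.card) *
        ((1 - r) ^ Fintype.card W) ^ F.card := by
        refine Finset.sum_le_sum fun F hF => mul_le_mul_of_nonneg_left (hempty F hF) ?_
        have := sub_nonneg.2 hq1
        positivity
    _ = ∑ F ∈ T.powerset, (q * (1 - r) ^ Fintype.card W) ^ F.card *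
        (1 - q) ^ (T.card - F.card) := by
        refine Finset.sum_congr rfl fun F _ => ?_
        rw [mul_pow]; ring
    _ = _ := by
        rw [Finset.sum_pow_mul_eq_add_pow]
        ring_nf

/-- Two-sided version: a bin contributes a factor `1 - q` if it is hit by balls of both kinds. -/
lemma sum_prod_mul_pow_hit_hit_le {X Y : Type*} [Fintype X] [Fintype Y] [DecidableEq X]
    [DecidableEq Y] (P : X ⊕ Y → β → ℝ) (hP0 : ∀ x o, 0 ≤ P x o)
    (hP1 : ∀ x, ∑ o, P x o = 1) (T : Finset β) {r q : ℝ} (hr0 : 0 ≤ r) (hr1 : r ≤ 1)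
    (hr : ∀ x, ∀ f ∈ T, P x f = r) (hq0 : 0 ≤ q) (hq1 : q ≤ 1) :
    ∑ l : X ⊕ Y → β, (∏ x, P x (l x)) *
        (1 - q) ^ (T.filter fun f => (∃ x, l (.inl x) = f) ∧ ∃ y, l (.inr y) = f).card ≤
      (1 - q * (1 - (1 - r) ^ Fintype.card Y) * (1 - (1 - r) ^ Fintype.card X)) ^ T.card := by
  have hpow : ∀ k : ℕ, 0 ≤ (1 - r) ^ k ∧ (1 - r) ^ k ≤ 1 := fun k =>
    ⟨pow_nonneg (by linarith) _, pow_le_one₀ (by linarith) (by linarith)⟩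
  have hq' : 0 ≤ q * (1 - (1 - r) ^ Fintype.card Y) :=
    mul_nonneg hq0 (by linarith [(hpow (Fintype.card Y)).2])
  have hq1' : q * (1 - (1 - r) ^ Fintype.card Y) ≤ 1 := by
    nlinarith [(hpow (Fintype.card Y)).1, (hpow (Fintype.card Y)).2]
  rw [← (Equiv.sumArrowEquivProdArrow X Y β).symm.sum_comp, Fintype.sum_prod_type]
  refine le_trans (Finset.sum_le_sum fun l _ => ?_)
    (sum_prod_mul_pow_hit_le (fun x => P (.inl x)) (fun x => hP0 _) (fun x => hP1 _) T hr1
      (fun x => hr _) hq' hq1')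
  have h := sum_prod_mul_pow_hit_le (fun y => P (.inr y)) (fun y => hP0 _) (fun y => hP1 _)
    (T.filter fun f => ∃ x, l x = f) hr1
    (fun y f hf => hr _ f (Finset.mem_filter.1 hf).1) hq0 hq1
  refine le_trans (le_of_eq ?_)
    (mul_le_mul_of_nonneg_left h (Finset.prod_nonneg fun x _ => hP0 (.inl x) (l x)))
  rw [Finset.mul_sum]
  refine Finset.sum_congr rfl fun l' _ => ?_
  rw [Fintype.prod_sum_type, Finset.filter_filter, mul_assoc]
  rfl

end BallsBins

section Core

variable {V W : Type*} [Fintype V] [Fintype W] [DecidableEq V] [DecidableEq W]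

/-- The number of pairs of `B` meeting a given pair. -/
lemma card_filter_meeting_le {B : Finset (Finset V)} (hB : ∀ g ∈ B, g.card = 2)
    {g : Finset V} (hg : g.card = 2) :
    (B.filter fun g' => (g ∩ g').Nonempty).card ≤ 2 * Fintype.card V := by
  have hsub : (B.filter fun g' => (g ∩ g').Nonempty) ⊆
      (g ×ˢ (Finset.univ : Finset V)).image fun z => {z.1, z.2} := by
    intro g' hg'
    obtain ⟨hg'B, v, hv⟩ := Finset.mem_filter.1 hg'
    obtain ⟨hvg, hvg'⟩ := Finset.mem_inter.1 hv
    obtain ⟨a, b, -, rfl⟩ := Finset.card_eq_two.1 (hB g' hg'B)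
    rw [Finset.mem_image]
    rcases Finset.mem_insert.1 hvg' with rfl | h
    · exact ⟨(v, b), by simp [hvg], rfl⟩
    · rw [Finset.mem_singleton] at h
      subst h
      exact ⟨(v, a), by simp [hvg], Finset.pair_comm _ _⟩
  refine (Finset.card_le_card hsub).trans (Finset.card_image_le.trans ?_)
  rw [Finset.card_product, hg, Finset.card_univ]

/-- The correlation sum in the second-moment computation. -/
lemma sum_sum_pow_card_union_le {B : Finset (Finset V)} (hB : ∀ g ∈ B, g.card = 2) (p : ℝ) :
    ∑ g ∈ B, ∑ g' ∈ B, p ^ (2 * (g ∪ g').card) ≤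
      B.card * (p ^ 4 + 2 * Fintype.card V * p ^ 6 + B.card * p ^ 8) := by
  rw [← nsmul_eq_mul]
  refine Finset.sum_le_card_nsmul _ _ _ fun g hg => ?_
  have hpt : ∀ g' ∈ B, p ^ (2 * (g ∪ g').card) ≤
      (if g' = g then p ^ 4 else 0) + (if (g ∩ g').Nonempty then p ^ 6 else 0) + p ^ 8 := by
    intro g' hg'
    have hc := Finset.card_union_add_card_inter g g'
    rw [hB g hg, hB g' hg'] at hc
    have h4 : 0 ≤ p ^ 4 := by positivity
    have h6 : 0 ≤ p ^ 6 := by positivity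
    have h8 : 0 ≤ p ^ 8 := by positivity
    by_cases h : g' = g
    · subst h
      have : (g' ∪ g').card = 2 := by simp [hB g' hg']
      rw [this, if_pos rfl]
      split_ifs <;> norm_num <;> linarith
    · rw [if_neg h]
      by_cases h' : (g ∩ g').Nonempty
      · rw [if_pos h']
        have h1 : (g ∩ g').card ≠ 2 := fun h2 => h <| by
          have e1 := Finset.eq_of_subset_of_card_le (Finset.inter_subset_left (s₁ := g) (s₂ := g'))
            (by rw [h2, hB g hg])
          have e2 := Finset.eq_of_subset_of_card_le (Finset.inter_subset_right (s₁ := g) (s₂ := g'))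
            (by rw [h2, hB g' hg'])
          exact e2.symm.trans e1
        have h2 := h'.card_pos
        have h3 := Finset.card_le_card (Finset.inter_subset_left (s₁ := g) (s₂ := g'))
        rw [hB g hg] at h3
        have : (g ∪ g').card = 3 := by omega
        rw [this]
        norm_num
        linarith
      · rw [if_neg h']
        rw [Finset.not_nonempty_iff_eq_empty] at h'
        have : (g ∪ g').card = 4 := by rw [h', Finset.card_empty] at hc; omega
        rw [this]
        norm_num
  refine (Finset.sum_le_sum hpt).trans ?_
  rw [Finset.sum_add_distrib, Finset.sum_add_distrib, Finset.sum_ite_eq_of_mem' _ _ _ hg,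
    ← Finset.sum_filter, Finset.sum_const, Finset.sum_const, nsmul_eq_mul, nsmul_eq_mul]
  have h1 : ((B.filter fun g' => (g ∩ g').Nonempty).card : ℝ) ≤ 2 * Fintype.card V := by
    exact_mod_cast card_filter_meeting_le hB (hB g hg)
  gcongr

/-- The vertices `x`, `y` are non-adjacent and have some pair of `B` in their common
neighbourhood. -/
def linkEvent (B : Finset (Finset V)) (x y : W) : Set (Sym2 (V ⊕ W) → Bool) :=
  {ω | ω s(.inr x, .inr y) = false ∧
    ∃ g ∈ B, ∀ v ∈ g, ω s(.inl v, .inr x) = true ∧ ω s(.inl v, .inr y) = true}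

/-- The coordinates that connect `x` and `y` to each other and to the vertices of `S`. -/
def linkCoords (S : Finset V) (x y : W) : Finset (Sym2 (V ⊕ W)) :=
  insert s(.inr x, .inr y)
    ((S.image fun v => s(.inl v, .inr x)) ∪ S.image fun v => s(.inl v, .inr y))

omit [Fintype V] [Fintype W] in
lemma card_linkCoords (S : Finset V) {x y : W} (hxy : x ≠ y) :
    (linkCoords S x y).card = 2 * S.card + 1 := by
  rw [linkCoords, Finset.card_insert_of_notMem (by simp), Finset.card_union_of_disjoint,
    Finset.card_image_of_injective, Finset.card_image_of_injective]
  · ring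
  · intro a b h; simpa using h
  · intro a b h; simpa using h
  · rw [Finset.disjoint_left]
    simp only [Finset.mem_image, not_exists, not_and]
    rintro _ ⟨v, -, rfl⟩ u -
    simp [hxy.symm]

omit [Fintype V] [Fintype W] in
lemma determinedBy_linkEvent {B : Finset (Finset V)} {S : Finset V} (hBS : ∀ g ∈ B, g ⊆ S)
    (x y : W) : DeterminedBy (linkEvent B x y) (linkCoords S x y) := by
  intro ω ω' h
  simp only [linkEvent, Set.mem_ofPred_eq]
  rw [h _ (by simp [linkCoords])]
  refine and_congr_right fun _ => exists_congr fun g => and_congr_right fun hg =>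
    forall₂_congr fun v hv => ?_
  have hvS := hBS g hg hv
  rw [h s(.inl v, .inr x) (by simp [linkCoords, hvS]),
    h s(.inl v, .inr y) (by simp [linkCoords, hvS])]

lemma pi_bernoulliBool_link_pair {p : ℝ} (h0 : 0 ≤ p) (h1 : p ≤ 1) (S : Finset V) {x y : W}
    (hxy : x ≠ y) :
    (Measure.pi fun _ : Sym2 (V ⊕ W) => bernoulliBool p).real
      {ω | ω s(.inr x, .inr y) = false ∧
        ∀ v ∈ S, ω s(.inl v, .inr x) = true ∧ ω s(.inl v, .inr y) = true} =
      (1 - p) * p ^ (2 * S.card) := by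
  have hset : {ω : Sym2 (V ⊕ W) → Bool | ω s(.inr x, .inr y) = false ∧
        ∀ v ∈ S, ω s(.inl v, .inr x) = true ∧ ω s(.inl v, .inr y) = true} =
      {ω | ∀ i ∈ linkCoords S x y, ω i = decide (i ≠ s(.inr x, .inr y))} := by
    ext ω
    simp only [Set.mem_ofPred_eq, linkCoords, Finset.forall_mem_insert, Finset.mem_union, or_imp,
      forall_and, Finset.forall_mem_image]
    simp
  have hnm : s(Sum.inr x, Sum.inr y) ∉
      ((S.image fun v => s(Sum.inl v, Sum.inr x)) ∪
        S.image fun v => s(Sum.inl v, Sum.inr y) : Finset (Sym2 (V ⊕ W))) := by simp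
  have hcard := card_linkCoords S hxy
  rw [linkCoords, Finset.card_insert_of_notMem hnm] at hcard
  rw [hset, pi_bernoulliBool_cylinder h0 h1, linkCoords, Finset.prod_insert hnm,
    Finset.prod_congr rfl (g := fun _ => p), Finset.prod_const, Nat.succ_injective hcard]
  · simp
  · intro i hi
    have : i ≠ s(Sum.inr x, Sum.inr y) := fun h => hnm (h ▸ hi)
    simp [this]

lemma le_linkEvent {p : ℝ} (h0 : 0 ≤ p) (h1 : p ≤ 1) {B : Finset (Finset V)}
    (hB : ∀ g ∈ B, g.card = 2) {x y : W} (hxy : x ≠ y) (t : ℝ) :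
    (1 - p) * B.card * (2 * t * p ^ 4 -
        t ^ 2 * (p ^ 4 + 2 * Fintype.card V * p ^ 6 + B.card * p ^ 8)) ≤
      (Measure.pi fun _ : Sym2 (V ⊕ W) => bernoulliBool p).real (linkEvent B x y) := by
  have := isProbabilityMeasure_bernoulliBool h0 h1
  set E : Finset V → Set (Sym2 (V ⊕ W) → Bool) := fun S => {ω | ω s(.inr x, .inr y) = false ∧
        ∀ v ∈ S, ω s(.inl v, .inr x) = true ∧ ω s(.inl v, .inr y) = true} with hE
  have hU : linkEvent B x y = ⋃ g ∈ B, E g := by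
    ext ω
    simp [linkEvent, hE]
  have hI : ∀ g g', E g ∩ E g' = E (g ∪ g') := by
    intro g g'
    ext ω
    simp only [hE, Set.mem_inter_iff, Set.mem_ofPred_eq, Finset.mem_union, or_imp, forall_and]
    tauto
  have hm : ∀ S, (Measure.pi fun _ : Sym2 (V ⊕ W) => bernoulliBool p).real (E S) =
      (1 - p) * p ^ (2 * S.card) := fun S => pi_bernoulliBool_link_pair h0 h1 S hxy
  have h2 := second_moment_union (Measure.pi fun _ : Sym2 (V ⊕ W) => bernoulliBool p) B E t
  rw [← hU] at h2
  refine le_trans ?_ h2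
  simp only [hI, hm, ← Finset.mul_sum]
  rw [Finset.sum_congr rfl (g := fun _ => p ^ 4) (fun g hg => by rw [hB g hg]), Finset.sum_const,
    nsmul_eq_mul]
  have h3 := mul_le_mul_of_nonneg_left (sum_sum_pow_card_union_le hB p)
    (mul_nonneg (sq_nonneg t) (sub_nonneg.2 h1))
  linarith

omit [Fintype V] [Fintype W] in
lemma determinedBy_label (U o : Finset V) (x : W) :
    DeterminedBy {ω : Sym2 (V ⊕ W) → Bool | U.filter (fun u => ω s(.inl u, .inr x) = true) = o}
      (U.image fun u => s(.inl u, .inr x)) := by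
  intro ω ω' h
  simp only [Set.mem_ofPred_eq]
  rw [Finset.filter_congr fun u hu => by rw [h _ (Finset.mem_image_of_mem _ hu)]]

lemma pi_bernoulliBool_label {p : ℝ} (h0 : 0 ≤ p) (h1 : p ≤ 1) {U f : Finset V} (hf : f ⊆ U)
    (x : W) :
    (Measure.pi fun _ : Sym2 (V ⊕ W) => bernoulliBool p).real
      {ω | U.filter (fun u => ω s(.inl u, .inr x) = true) = f} =
      p ^ f.card * (1 - p) ^ (U.card - f.card) := by
  have hinj : Function.Injective fun u : V => (s(.inl u, .inr x) : Sym2 (V ⊕ W)) := by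
    intro a b h
    simpa using h
  have hset : {ω : Sym2 (V ⊕ W) → Bool | U.filter (fun u => ω s(.inl u, .inr x) = true) = f} =
      {ω | ∀ i ∈ U.image fun u => s(.inl u, .inr x),
        ω i = decide (i ∈ f.image fun u => s(.inl u, .inr x))} := by
    ext ω
    simp only [Set.mem_ofPred_eq, Finset.forall_mem_image, hinj.mem_finset_image]
    constructor
    · intro h u hu
      have : u ∈ f ↔ ω s(.inl u, .inr x) = true := by
        rw [← h, Finset.mem_filter, and_iff_right hu]
      by_cases huf : u ∈ f
      · simp [huf, this.1 huf]
      · simp only [huf, decide_false]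
        simpa using mt this.2 huf
    · intro h
      ext u
      rw [Finset.mem_filter]
      constructor
      · rintro ⟨hu, hω⟩
        rw [h hu] at hω
        simpa using hω
      · intro huf
        exact ⟨hf huf, by rw [h (hf huf)]; simpa using huf⟩
  rw [hset, pi_bernoulliBool_cylinder h0 h1, Finset.prod_image hinj.injOn]
  simp only [hinj.mem_finset_image, decide_eq_true_eq]
  rw [Finset.prod_ite, Finset.prod_const, Finset.prod_const, Finset.filter_mem_eq_inter,
    Finset.inter_eq_right.2 hf, Finset.filter_not, Finset.filter_mem_eq_inter,
    Finset.inter_eq_right.2 hf, Finset.card_sdiff_of_subset hf]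

/-- The probability that no two vertices of `W` link a pair of `A` to a pair of `B`. -/
theorem pi_bernoulliBool_no_link_le {X Y : Type*} [Fintype X] [Fintype Y] [DecidableEq X]
    [DecidableEq Y] (σ : X ⊕ Y ↪ W) {p : ℝ} (h0 : 0 ≤ p) (h1 : p ≤ 1)
    {A B : Finset (Finset V)} (hA : ∀ f ∈ A, f.card = 2) {U : Finset V}
    (hU : ∀ f ∈ A, f ⊆ U) (hBU : ∀ g ∈ B, Disjoint g U) {q : ℝ} (hq0 : 0 ≤ q)
    (hq : ∀ x y : W, x ≠ y →
      q ≤ (Measure.pi fun _ : Sym2 (V ⊕ W) => bernoulliBool p).real (linkEvent B x y)) :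
    (Measure.pi fun _ : Sym2 (V ⊕ W) => bernoulliBool p).real
      {ω | ¬ ∃ f ∈ A, ∃ x y : W, x ≠ y ∧
        (∀ v ∈ f, ω s(.inl v, .inr x) = true ∧ ω s(.inl v, .inr y) = true) ∧
        ω ∈ linkEvent B x y} ≤
      (1 - q * (1 - (1 - p ^ 2 * (1 - p) ^ (U.card - 2)) ^ Fintype.card Y) *
        (1 - (1 - p ^ 2 * (1 - p) ^ (U.card - 2)) ^ Fintype.card X)) ^ A.card := by
  have := isProbabilityMeasure_bernoulliBool h0 h1
  set μ := Measure.pi fun _ : Sym2 (V ⊕ W) => bernoulliBool p with hμ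
  set F : Set (Sym2 (V ⊕ W) → Bool) := {ω | ¬ ∃ f ∈ A, ∃ x y : W, x ≠ y ∧
        (∀ v ∈ f, ω s(.inl v, .inr x) = true ∧ ω s(.inl v, .inr y) = true) ∧
        ω ∈ linkEvent B x y} with hF
  set L : X ⊕ Y → Finset V → Set (Sym2 (V ⊕ W) → Bool) := fun z o =>
    {ω | U.filter (fun u => ω s(.inl u, .inr (σ z)) = true) = o} with hL
  by_cases hXY : IsEmpty X ∨ IsEmpty Y
  · have : Fintype.card X = 0 ∨ Fintype.card Y = 0 := by
      simpa [Fintype.card_eq_zero_iff] using hXY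
    rcases this with h | h <;> simp [h, measureReal_le_one]
  obtain ⟨⟨x₀⟩, ⟨y₀⟩⟩ : Nonempty X ∧ Nonempty Y := by simpa [not_or] using hXY
  have hq1 : q ≤ 1 := (hq (σ (.inl x₀)) (σ (.inr y₀)) (by simp)).trans measureReal_le_one
  have hr0 : 0 ≤ p ^ 2 * (1 - p) ^ (U.card - 2) := by
    have := sub_nonneg.2 h1
    positivity
  have hr1 : p ^ 2 * (1 - p) ^ (U.card - 2) ≤ 1 :=
    mul_le_one₀ (pow_le_one₀ h0 h1) (pow_nonneg (by linarith) _)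
      (pow_le_one₀ (by linarith) (by linarith))
  refine le_trans ?_ (sum_prod_mul_pow_hit_hit_le (fun z o => μ.real (L z o))
    (fun _ _ => measureReal_nonneg) ?_ A hr0 hr1 ?_ hq0 hq1)
  · have hcover : F ⊆ ⋃ l ∈ (Finset.univ : Finset (X ⊕ Y → Finset V)), F ∩ ⋂ z, L z (l z) := by
      intro ω hω
      simp only [Finset.mem_univ, Set.iUnion_true, Set.mem_iUnion, Set.mem_inter_iff,
        Set.mem_iInter]
      exact ⟨fun z => U.filter (fun u => ω s(.inl u, .inr (σ z)) = true), hω, fun z => rfl⟩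
    refine (measureReal_mono hcover (measure_ne_top _ _)).trans ((measureReal_biUnion_finset_le _ _).trans ?_)
    refine Finset.sum_le_sum fun l _ => ?_
    set T := A.filter fun f => (∃ x, l (.inl x) = f) ∧ ∃ y, l (.inr y) = f with hT
    have hTl : ∀ f : T, ∃ x y, l (.inl x) = f ∧ l (.inr y) = f := fun f => by
      obtain ⟨-, ⟨x, hx⟩, y, hy⟩ := Finset.mem_filter.1 f.2
      exact ⟨x, y, hx, hy⟩
    choose x y hx hy using hTl
    set E : (X ⊕ Y) ⊕ T → Set (Sym2 (V ⊕ W) → Bool) :=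
      Sum.elim (fun z => L z (l z)) fun f => (linkEvent B (σ (.inl (x f))) (σ (.inr (y f))))ᶜ
    set S : (X ⊕ Y) ⊕ T → Finset (Sym2 (V ⊕ W)) :=
      Sum.elim (fun z => U.image fun u => s(.inl u, .inr (σ z)))
        fun f => linkCoords Uᶜ (σ (.inl (x f))) (σ (.inr (y f)))
    have hsub : F ∩ ⋂ z, L z (l z) ⊆ ⋂ j ∈ (Finset.univ : Finset ((X ⊕ Y) ⊕ T)), E j := by
      rintro ω ⟨hωF, hωL⟩
      simp only [Finset.mem_univ, Set.iInter_true, Set.mem_iInter]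
      rw [Set.mem_iInter] at hωL
      rintro (z | f)
      · exact hωL z
      · intro hlink
        refine hωF ⟨f, (Finset.mem_filter.1 f.2).1, _, _, by simp, fun v hv => ?_, hlink⟩
        have e1 := hωL (.inl (x f))
        have e2 := hωL (.inr (y f))
        simp only [hL, Set.mem_ofPred_eq, hx, hy] at e1 e2
        have hv₁ := hv
        have hv₂ := hv
        rw [← e1] at hv₁
        rw [← e2] at hv₂
        exact ⟨(Finset.mem_filter.1 hv₁).2, (Finset.mem_filter.1 hv₂).2⟩
    refine (measureReal_mono hsub (measure_ne_top _ _)).trans ?_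
    rw [pi_bernoulliBool_biInter h0 h1 _ (S := S), Fintype.prod_sum_type]
    · refine mul_le_mul_of_nonneg_left ?_ (Finset.prod_nonneg fun _ _ => measureReal_nonneg)
      have hle : ∀ f ∈ (Finset.univ : Finset T), μ.real (E (.inr f)) ≤ 1 - q := fun f _ => by
        have hc := probReal_compl_eq_one_sub (μ := μ)
          (s := linkEvent B (σ (.inl (x f))) (σ (.inr (y f)))) .of_discrete
        have := hq (σ (.inl (x f))) (σ (.inr (y f))) (by simp)
        change μ.real (linkEvent B (σ (.inl (x f))) (σ (.inr (y f))))ᶜ ≤ 1 - q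
        linarith
      refine (Finset.prod_le_prod (fun _ _ => measureReal_nonneg) hle).trans_eq ?_
      rw [Finset.prod_const, Finset.card_univ, Fintype.card_coe]
    · rintro (z | f) - (z' | f') - hne
      · simp only [Function.onFun, S, Sum.elim_inl, Finset.disjoint_left, Finset.mem_image]
        rintro _ ⟨u, -, rfl⟩ ⟨v, -, hv⟩
        simp only [Sym2.eq_iff] at hv
        simp_all
      · simp only [Function.onFun, S, Sum.elim_inl, Sum.elim_inr, Finset.disjoint_left,
          Finset.mem_image, linkCoords]
        rintro _ ⟨u, hu, rfl⟩
        simp [hu]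
      · simp only [Function.onFun, S, Sum.elim_inl, Sum.elim_inr, Finset.disjoint_right,
          Finset.mem_image, linkCoords]
        rintro _ ⟨u, hu, rfl⟩
        simp [hu]
      · have hff : f ≠ f' := fun h => hne (by rw [h])
        have hxx : x f ≠ x f' := fun h => hff (Subtype.ext (by rw [← hx f, ← hx f', h]))
        have hyy : y f ≠ y f' := fun h => hff (Subtype.ext (by rw [← hy f, ← hy f', h]))
        simp only [Function.onFun, S, Sum.elim_inr, Finset.disjoint_left, linkCoords,
          Finset.mem_insert, Finset.mem_union, Finset.mem_image]
        rintro _ (rfl | ⟨u, -, rfl⟩ | ⟨u, -, rfl⟩) <;> simp [hxx.symm, hyy.symm, hxx]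
    · rintro (z | f) -
      · exact determinedBy_label U (l z) (σ z)
      · exact (determinedBy_linkEvent (fun g hg v hv => Finset.mem_compl.2 fun hvU =>
          Finset.disjoint_left.1 (hBU g hg) hv hvU) _ _).compl
  · intro z
    have h := sum_measureReal_preimage_singleton (μ := μ) (Finset.univ : Finset (Finset V))
      (f := fun ω => U.filter (fun u => ω s(.inl u, .inr (σ z)) = true)) fun _ _ => .of_discrete
    rw [Finset.coe_univ, Set.preimage_univ, probReal_univ] at h
    exact h
  · intro z f hf
    have h := pi_bernoulliBool_label h0 h1 (hU f hf) (σ z)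
    rwa [hA f hf] at h

end Core

section Sprinkle

variable {m w : ℕ} {H : SimpleGraph (Fin m)} {ω : Sym2 (Fin m ⊕ Fin w) → Bool}

lemma sprinkleGraph_adj_inl_inl (a b : Fin m) :
    (sprinkleGraph m w H ω).Adj (.inl a) (.inl b) ↔ H.Adj a b := by
  simp only [sprinkleGraph, SimpleGraph.fromRel_adj, H.adj_comm b a, or_self, ne_eq,
    Sum.inl.injEq, and_iff_right_iff_imp]
  exact fun h => h.ne

lemma sprinkleGraph_adj_inl_inr (a : Fin m) (x : Fin w) :
    (sprinkleGraph m w H ω).Adj (.inl a) (.inr x) ↔ ω s(.inl a, .inr x) = true := by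
  simp [sprinkleGraph, SimpleGraph.fromRel_adj, Sym2.eq_swap (a := Sum.inr x)]

lemma sprinkleGraph_adj_inr_inr (x y : Fin w) :
    (sprinkleGraph m w H ω).Adj (.inr x) (.inr y) ↔ x ≠ y ∧ ω s(.inr x, .inr y) = true := by
  simp [sprinkleGraph, SimpleGraph.fromRel_adj, Sym2.eq_swap (a := Sum.inr y)]

lemma isNonEdge_map_inl {e : Sym2 (Fin m)} :
    IsNonEdge (sprinkleGraph m w H ω) (e.map .inl) ↔ IsNonEdge H e := by
  induction e with
  | _ a b => simp [IsNonEdge, sprinkleGraph_adj_inl_inl]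

lemma squareGraph_adj_of_squareAdj {V : Type*} {Γ : SimpleGraph V} {e f : Sym2 V}
    (h : squareAdj Γ e f) : (squareGraph Γ).Adj e f := by
  refine (SimpleGraph.fromRel_adj _ _ _).2 ⟨?_, Or.inl h⟩
  obtain ⟨a, b, c, d, rfl, rfl, -, -, -, -, hab, hbc, hcd, hda⟩ := h
  intro heq
  have : a ∈ s(b, d) := heq ▸ Sym2.mem_mk_left a c
  rcases Sym2.mem_iff.1 this with rfl | rfl
  · exact hab.ne rfl
  · exact hda.ne rfl

lemma squareAdj_map_inl {e f : Sym2 (Fin m)} (h : squareAdj H e f) :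
    squareAdj (sprinkleGraph m w H ω) (e.map .inl) (f.map .inl) := by
  obtain ⟨a, b, c, d, rfl, rfl, hac, hbd, nac, nbd, hab, hbc, hcd, hda⟩ := h
  refine ⟨.inl a, .inl b, .inl c, .inl d, rfl, rfl, by simpa, by simpa, ?_⟩
  simp only [sprinkleGraph_adj_inl_inl]
  exact ⟨nac, nbd, hab, hbc, hcd, hda⟩

lemma reachable_map_inl {e f : Sym2 (Fin m)} (h : (squareGraph H).Reachable e f) :
    (squareGraph (sprinkleGraph m w H ω)).Reachable (e.map .inl) (f.map .inl) := by
  refine h.map (G' := squareGraph (sprinkleGraph m w H ω)) ⟨Sym2.map Sum.inl, fun {e f} hef => ?_⟩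
  rcases ((SimpleGraph.fromRel_adj _ _ _).1 hef).2 with h | h
  · exact squareGraph_adj_of_squareAdj (squareAdj_map_inl h)
  · exact (squareGraph_adj_of_squareAdj (squareAdj_map_inl h)).symm

lemma isNonEdge_of_squareGraph_reachable {V : Type*} {Γ : SimpleGraph V} {e f : Sym2 V}
    (he : IsNonEdge Γ e) (h : (squareGraph Γ).Reachable e f) : IsNonEdge Γ f := by
  obtain ⟨p⟩ := h
  induction p with
  | nil => exact he
  | cons hadj _ ih =>
    refine ih ?_
    rcases ((SimpleGraph.fromRel_adj _ _ _).1 hadj).2 with h | h <;>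
    · obtain ⟨a, b, c, d, rfl, rfl, hac, hbd, nac, nbd, -⟩ := h
      simp [IsNonEdge, *]

/-- A non-adjacent pair of new vertices is square-adjacent to every non-edge of `H` in its
common neighbourhood. -/
lemma squareAdj_new_pair {f : Sym2 (Fin m)} (hf : IsNonEdge H f) {x y : Fin w} (hxy : x ≠ y)
    (hω : ω s(.inr x, .inr y) = false)
    (hfω : ∀ v ∈ f, ω s(.inl v, .inr x) = true ∧ ω s(.inl v, .inr y) = true) :
    squareAdj (sprinkleGraph m w H ω) (f.map .inl) s(.inr x, .inr y) := by
  induction f with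
  | _ a c =>
    have ha := hfω a (Sym2.mem_mk_left a c)
    have hc := hfω c (Sym2.mem_mk_right a c)
    simp only [IsNonEdge, Sym2.mk_isDiag_iff, SimpleGraph.mem_edgeSet] at hf
    refine ⟨.inl a, .inr x, .inl c, .inr y, rfl, rfl, by simpa using hf.1, by simpa, ?_⟩
    rw [(sprinkleGraph m w H ω).adj_comm (.inr x) (.inl c),
      (sprinkleGraph m w H ω).adj_comm (.inr y) (.inl a)]
    simp only [sprinkleGraph_adj_inl_inl, sprinkleGraph_adj_inl_inr, sprinkleGraph_adj_inr_inr]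
    simp [hf.2, hω, ha, hc]

/-- If every component of order in `[M, 2M)` is merged with another component of order at least
`M`, then all pairs in components of order at least `M` end up in components of order at least
`2M`. -/
lemma ncard_big_le_of_merge {M : ℝ}
    (h : ∀ e, IsNonEdge H e → M ≤ ((squareComponent H e).ncard : ℝ) →
      ((squareComponent H e).ncard : ℝ) < 2 * M →
      ∃ f ∈ squareComponent H e, ∃ g ∈ {e | IsNonEdge H e ∧ M ≤ ((squareComponent H e).ncard : ℝ)},
        g ∉ squareComponent H e ∧
        (squareGraph (sprinkleGraph m w H ω)).Reachable (f.map .inl) (g.map .inl)) :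
    Set.ncard {e | IsNonEdge H e ∧ M ≤ ((squareComponent H e).ncard : ℝ)} ≤
      Set.ncard {e | IsNonEdge (sprinkleGraph m w H ω) e ∧
        2 * M ≤ ((squareComponent (sprinkleGraph m w H ω) e).ncard : ℝ)} := by
  have hinj : Function.Injective (Sym2.map (Sum.inl : Fin m → Fin m ⊕ Fin w)) :=
    Sym2.map.injective Sum.inl_injective
  refine Set.ncard_le_ncard_of_injOn (Sym2.map Sum.inl) ?_ hinj.injOn (Set.toFinite _)
  rintro e ⟨he, hM⟩
  refine ⟨isNonEdge_map_inl.2 he, ?_⟩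
  have hsub : ∀ g, (squareGraph (sprinkleGraph m w H ω)).Reachable (e.map .inl) (g.map .inl) →
      Sym2.map .inl '' squareComponent H g ⊆
        squareComponent (sprinkleGraph m w H ω) (e.map .inl) := by
    rintro g hg _ ⟨f, hf, rfl⟩
    exact hg.trans (reachable_map_inl hf)
  rcases lt_or_ge ((squareComponent H e).ncard : ℝ) (2 * M) with hlt | hge
  · obtain ⟨f, hf, g, hg, hgC, hfg⟩ := h e he hM hlt
    have hdisj : Disjoint (squareComponent H e) (squareComponent H g) := by
      rw [Set.disjoint_left]
      intro k hk hk'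
      exact hgC (SimpleGraph.Reachable.trans hk (SimpleGraph.Reachable.symm hk'))
    have hle := Set.ncard_le_ncard (Set.union_subset (hsub e (SimpleGraph.Reachable.refl _))
      (hsub g ((reachable_map_inl hf).trans hfg))) (Set.toFinite _)
    rw [← Set.image_union, Set.ncard_image_of_injective _ hinj, Set.ncard_union_eq hdisj] at hle
    have hle' : ((squareComponent H e).ncard : ℝ) + (squareComponent H g).ncard ≤
        (squareComponent (sprinkleGraph m w H ω) (e.map .inl)).ncard := by exact_mod_cast hle
    linarith [hg.2]
  · have hle := Set.ncard_le_ncard (hsub e (SimpleGraph.Reachable.refl _)) (Set.toFinite _)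
    rw [Set.ncard_image_of_injective _ hinj] at hle
    exact hge.trans (by exact_mod_cast hle)

lemma card_meeting_le (U : Finset (Fin m)) :
    (Finset.univ.filter fun e : Sym2 (Fin m) => ¬ Disjoint e.toFinset U).card ≤ U.card * m := by
  have hsub : (Finset.univ.filter fun e : Sym2 (Fin m) => ¬ Disjoint e.toFinset U) ⊆
      (U ×ˢ (Finset.univ : Finset (Fin m))).image fun z => s(z.1, z.2) := by
    intro e he
    obtain ⟨v, hv, hvU⟩ := Finset.not_disjoint_iff.1 (Finset.mem_filter.1 he).2
    rw [Sym2.mem_toFinset] at hv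
    rw [Finset.mem_image]
    exact ⟨(v, Sym2.Mem.other hv), by simp [hvU], Sym2.other_spec hv⟩
  refine (Finset.card_le_card hsub).trans (Finset.card_image_le.trans ?_)
  simp

lemma Sym2.toFinset_inj {α : Type*} [DecidableEq α] :
    Function.Injective (Sym2.toFinset : Sym2 α → Finset α) := fun e f h => by
  ext v
  rw [← Sym2.mem_toFinset, h, Sym2.mem_toFinset]

/-- The probability that a set `C` of non-edges of order at least `K` is not merged with a
member of `D` outside `C`. -/
theorem sprinkleMeasure_not_merge_le {p : ℝ} (h0 : 0 ≤ p) (h1 : p ≤ 1) {k K b : ℕ}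
    (hk : k + k ≤ w) {C D : Set (Sym2 (Fin m))} (hC : ∀ e ∈ C, IsNonEdge H e)
    (hD : ∀ e ∈ D, IsNonEdge H e) (hK : K ≤ C.ncard) (hb : b + C.ncard + 2 * K * m ≤ D.ncard)
    {q t : ℝ} (hq0 : 0 ≤ q)
    (hq : q ≤ (1 - p) * b * (2 * t * p ^ 4 - t ^ 2 * (p ^ 4 + 2 * m * p ^ 6 + b * p ^ 8))) :
    (sprinkleMeasure m w p).real
      {ω | ¬ ∃ f ∈ C, ∃ g ∈ D, g ∉ C ∧
        (squareGraph (sprinkleGraph m w H ω)).Reachable (f.map .inl) (g.map .inl)} ≤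
      (1 - q * (1 - (1 - p ^ 2 * (1 - p) ^ (2 * K)) ^ k) ^ 2) ^ K := by
  classical
  have := isProbabilityMeasure_bernoulliBool h0 h1
  obtain ⟨A₀, hA₀C, hA₀K⟩ := Finset.exists_subset_card_eq
    (show K ≤ C.toFinset.card by rwa [← Set.ncard_eq_toFinset_card'])
  set U := A₀.biUnion Sym2.toFinset with hU
  have hA₀mem : ∀ e ∈ A₀, e ∈ C := fun e he => Set.mem_toFinset.1 (hA₀C he)
  have hcard2 : ∀ e, IsNonEdge H e → e.toFinset.card = 2 := fun e he =>
    Sym2.card_toFinset_of_not_isDiag e he.1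
  have hUcard : U.card ≤ 2 * K := by
    rw [mul_comm, ← hA₀K]
    exact Finset.card_biUnion_le_card_mul _ _ _ fun e he => (hcard2 e (hC e (hA₀mem e he))).le
  have hBcard : b ≤ ((D.toFinset \ C.toFinset) \
      Finset.univ.filter fun e : Sym2 (Fin m) => ¬ Disjoint e.toFinset U).card := by
    have h2 := Finset.le_card_sdiff
      (Finset.univ.filter fun e : Sym2 (Fin m) => ¬ Disjoint e.toFinset U)
      (D.toFinset \ C.toFinset)
    have h3 := Finset.le_card_sdiff C.toFinset D.toFinset
    have h4 := (card_meeting_le U).trans (Nat.mul_le_mul_right m hUcard)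
    rw [← Set.ncard_eq_toFinset_card', ← Set.ncard_eq_toFinset_card'] at h3
    omega
  obtain ⟨B₀, hB₀, hB₀b⟩ := Finset.exists_subset_card_eq hBcard
  have hB₀mem : ∀ e ∈ B₀, e ∈ D ∧ e ∉ C ∧ Disjoint e.toFinset U := fun e he => by
    simpa [and_assoc] using hB₀ he
  have hAcard : (A₀.image Sym2.toFinset).card = K := by
    rw [Finset.card_image_of_injective _ Sym2.toFinset_inj, hA₀K]
  have hBcard' : (B₀.image Sym2.toFinset).card = b := by
    rw [Finset.card_image_of_injective _ Sym2.toFinset_inj, hB₀b]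
  have hA2 : ∀ f ∈ A₀.image Sym2.toFinset, f.card = 2 := by
    rw [Finset.forall_mem_image]
    exact fun e he => hcard2 e (hC e (hA₀mem e he))
  have hB2 : ∀ f ∈ B₀.image Sym2.toFinset, f.card = 2 := by
    rw [Finset.forall_mem_image]
    exact fun e he => hcard2 e (hD e (hB₀mem e he).1)
  have hAU : ∀ f ∈ A₀.image Sym2.toFinset, f ⊆ U := by
    rw [Finset.forall_mem_image]
    exact fun e he => Finset.subset_biUnion_of_mem _ he
  have hBU : ∀ f ∈ B₀.image Sym2.toFinset, Disjoint f U := by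
    rw [Finset.forall_mem_image]
    exact fun e he => (hB₀mem e he).2.2
  have hlink : ∀ x y : Fin w, x ≠ y →
      q ≤ (Measure.pi fun _ : Sym2 (Fin m ⊕ Fin w) => bernoulliBool p).real
        (linkEvent (B₀.image Sym2.toFinset) x y) := fun x y hxy => by
    have h := le_linkEvent h0 h1 hB2 hxy t
    rw [hBcard', Fintype.card_fin] at h
    exact hq.trans h
  have hmain := pi_bernoulliBool_no_link_le
    (finSumFinEquiv.toEmbedding.trans (Fin.castLEEmb hk)) h0 h1 hA2 hAU hBU hq0 hlink
  have hsub : {ω | ¬ ∃ f ∈ C, ∃ g ∈ D, g ∉ C ∧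
        (squareGraph (sprinkleGraph m w H ω)).Reachable (f.map .inl) (g.map .inl)} ⊆
      {ω | ¬ ∃ f ∈ A₀.image Sym2.toFinset, ∃ x y : Fin w, x ≠ y ∧
        (∀ v ∈ f, ω s(.inl v, .inr x) = true ∧ ω s(.inl v, .inr y) = true) ∧
        ω ∈ linkEvent (B₀.image Sym2.toFinset) x y} := by
    rintro ω hω ⟨f', hf', x, y, hxy, hfω, hxyω, g', hg', hgω⟩
    obtain ⟨f, hf, rfl⟩ := Finset.mem_image.1 hf'
    obtain ⟨g, hg, rfl⟩ := Finset.mem_image.1 hg'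
    simp only [Sym2.mem_toFinset] at hfω hgω
    have hfC := hA₀mem f hf
    obtain ⟨hgD, hgC, -⟩ := hB₀mem g hg
    have ef := squareAdj_new_pair (hC f hfC) hxy hxyω hfω
    have eg := squareAdj_new_pair (hD g hgD) hxy hxyω hgω
    exact hω ⟨f, hfC, g, hgD, hgC, (squareGraph_adj_of_squareAdj ef).reachable.trans
      (squareGraph_adj_of_squareAdj eg).reachable.symm⟩
  rw [sprinkleMeasure]
  refine (measureReal_mono hsub (measure_ne_top _ _)).trans (hmain.trans ?_)
  rw [hAcard, Fintype.card_fin]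
  set ρ := p ^ 2 * (1 - p) ^ (U.card - 2) with hρ
  set ρ' := p ^ 2 * (1 - p) ^ (2 * K) with hρ'
  have hp' := sub_nonneg.2 h1
  have hρ'0 : 0 ≤ ρ' := by positivity
  have hρρ : ρ' ≤ ρ := mul_le_mul_of_nonneg_left
    (pow_le_pow_of_le_one hp' (by linarith) (by omega)) (sq_nonneg p)
  have hρ1 : ρ ≤ 1 := mul_le_one₀ (pow_le_one₀ h0 h1) (pow_nonneg hp' _)
    (pow_le_one₀ hp' (by linarith))
  have hpow : (1 - ρ) ^ k ≤ (1 - ρ') ^ k := pow_le_pow_left₀ (by linarith) (by linarith) k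
  have hpow0 : 0 ≤ (1 - ρ) ^ k := pow_nonneg (by linarith) k
  have hpow1 : (1 - ρ') ^ k ≤ 1 := pow_le_one₀ (by linarith) (by linarith)
  have hsq : (1 - (1 - ρ') ^ k) ^ 2 ≤ (1 - (1 - ρ) ^ k) ^ 2 :=
    pow_le_pow_left₀ (by linarith) (by linarith) 2
  have hsq1 : (1 - (1 - ρ) ^ k) ^ 2 ≤ 1 := pow_le_one₀ (by linarith) (by linarith)
  have hq1 : q * (1 - (1 - ρ) ^ k) ^ 2 ≤ 1 := by
    rcases Nat.eq_zero_or_pos k with rfl | hkpos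
    · simp
    · have hq1 : q ≤ 1 := (hlink ⟨0, by omega⟩ ⟨1, by omega⟩ (by simp)).trans measureReal_le_one
      exact mul_le_one₀ hq1 (sq_nonneg _) hsq1
  rw [mul_assoc, ← sq]
  refine pow_le_pow_left₀ (by linarith) ?_ K
  linarith [mul_le_mul_of_nonneg_left hsq hq0]

end Sprinkle

section Estimates

lemma le_sq_of_lambdaC_lt {lam : ℝ} (h : lambdaC < lam) : 0 < lam ∧ 0.449 ≤ lam ^ 2 := by
  have h6 : (2.449 : ℝ) ≤ √6 := Real.le_sqrt_of_sq_le (by norm_num)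
  have h0 : 0 ≤ lambdaC := Real.sqrt_nonneg _
  have hsq : lambdaC ^ 2 = √6 - 2 := Real.sq_sqrt (by linarith)
  refine ⟨h0.trans_lt h, ?_⟩
  nlinarith

/-- The conclusion of the second-moment method, at the optimal parameter. -/
lemma link_bound {n m b p ε : ℝ} (hn : 0 < n) (hm0 : 0 ≤ m) (hm : m ≤ n) (hε0 : 0 < ε)
    (hε1 : ε ≤ 1) (hb : 0.4 * ε * n ^ 2 ≤ b) (hp : 0.449 ≤ n * p ^ 2) (hp1 : p ≤ 0.1) :
    0.036 * ε ≤ (1 - p) * b * (2 * (1 / (1 + 2 * m * p ^ 2 + b * p ^ 4)) * p ^ 4 -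
      (1 / (1 + 2 * m * p ^ 2 + b * p ^ 4)) ^ 2 *
        (p ^ 4 + 2 * m * p ^ 6 + b * p ^ 8)) := by
  set s := n * p ^ 2 with hs
  set x := b * p ^ 4 with hx
  have hb0 : 0 ≤ b := le_trans (by positivity) hb
  have hx0 : 0 ≤ x := by positivity
  have hxs : 0.4 * ε * s ^ 2 ≤ x := by
    have := mul_le_mul_of_nonneg_right hb (by positivity : 0 ≤ p ^ 4)
    calc _ = 0.4 * ε * n ^ 2 * p ^ 4 := by rw [hs]; ring
      _ ≤ _ := this
  set a := 1 + 2 * m * p ^ 2 + x with ha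
  have ha0 : 0 < a := by positivity
  have has : a ≤ 1 + 2 * s + x := by
    have := mul_le_mul_of_nonneg_right hm (sq_nonneg p)
    linarith
  have heq : (1 - p) * b * (2 * (1 / a) * p ^ 4 -
      (1 / a) ^ 2 * (p ^ 4 + 2 * m * p ^ 6 + b * p ^ 8)) = (1 - p) * (x / a) := by
    have h1 : p ^ 4 + 2 * m * p ^ 6 + b * p ^ 8 = p ^ 4 * a := by rw [ha, hx]; ring
    rw [h1]
    field_simp
    rw [hx]
    ring
  rw [heq]
  have hxa : 0.04 * ε ≤ x / a := by
    rw [le_div_iff₀ ha0]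
    have h1 : 0.04 * ε * a ≤ 0.04 * ε * (1 + 2 * s + x) :=
      mul_le_mul_of_nonneg_left has (by positivity)
    have h2 : 0.04 * ε * x ≤ 0.04 * x := by nlinarith
    have h3 : 0 ≤ 9.6 * s ^ 2 - 1 - 2 * s := by nlinarith
    nlinarith [mul_nonneg hε0.le h3]
  nlinarith

/-- The probability that a given pair is the label of one of `k` vertices. -/
lemma hit_bound {n p L ε : ℝ} {k K : ℕ} (hn : 0 < n) (hp0 : 0 ≤ p) (hp : 0.449 ≤ n * p ^ 2)
    (hp1 : p ≤ 1) (hKp : 2 * K * p ≤ 0.1) (hL : 0 < L) (hε : 0 < ε)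
    (hk : 0.17 * ε * n / L ≤ k) (hz : 0.068 * ε / L ≤ 0.1) :
    0.06 * ε / L ≤ 1 - (1 - p ^ 2 * (1 - p) ^ (2 * K)) ^ k := by
  set ρ := p ^ 2 * (1 - p) ^ (2 * K) with hρ
  have hp' := sub_nonneg.2 hp1
  have hρ1 : ρ ≤ 1 := mul_le_one₀ (pow_le_one₀ hp0 hp1) (pow_nonneg hp' _)
    (pow_le_one₀ hp' (by linarith))
  have hpow : 0.9 ≤ (1 - p) ^ (2 * K) := by
    have := one_add_mul_le_pow (a := -p) (by linarith) (2 * K)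
    rw [← sub_eq_add_neg] at this
    push_cast at this
    linarith
  have hρn : 0.4 / n ≤ ρ := by
    rw [div_le_iff₀ hn]
    calc (0.4 : ℝ) ≤ 0.449 * 0.9 := by norm_num
      _ ≤ (n * p ^ 2) * (1 - p) ^ (2 * K) := by gcongr
      _ = ρ * n := by rw [hρ]; ring
  set z := 0.068 * ε / L with hz'
  have hz0 : 0 < z := by positivity
  have hzk : z ≤ ρ * k := by
    calc z = 0.4 / n * (0.17 * ε * n / L) := by rw [hz']; field_simp; norm_num
      _ ≤ ρ * k := by gcongr
  have h1 : (1 - ρ) ^ k ≤ Real.exp (-(ρ * k)) := by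
    calc (1 - ρ) ^ k ≤ Real.exp (-ρ) ^ k :=
        pow_le_pow_left₀ (by linarith) (Real.one_sub_le_exp_neg ρ) k
      _ = _ := by rw [← Real.exp_nat_mul]; ring_nf
  have h2 : Real.exp (-(ρ * k)) ≤ 1 / (1 + z) := by
    rw [Real.exp_neg, one_div]
    exact inv_anti₀ (by linarith) (by linarith [Real.add_one_le_exp (ρ * k)])
  have h3 : 0.9 * z ≤ 1 - 1 / (1 + z) := by
    have h4 : 1 - 1 / (1 + z) = z / (1 + z) := by field_simp; ring
    rw [h4, le_div_iff₀ (by linarith)]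
    nlinarith
  have h5 : 0.06 * ε / L ≤ 0.9 * z := by
    calc 0.06 * ε / L ≤ 0.0612 * ε / L := by gcongr; norm_num
      _ = 0.9 * z := by rw [hz']; ring
  linarith

lemma one_sub_pow_le_exp {q h L ε₁ ε₂ : ℝ} {K : ℕ} (hL : 0 < L) (hK : L ^ 4 ≤ K)
    (hε₁ : 0 < ε₁) (hε₂ : 0 < ε₂) (hε₂1 : ε₂ ≤ 1) (hq : q = 0.036 * ε₂)
    (hh : 0.06 * ε₁ / L ≤ h) (hh1 : h ≤ 1) :
    (1 - q * h ^ 2) ^ K ≤ Real.exp (-(0.000129 * (ε₂ * ε₁ ^ 2 * L ^ 2))) := by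
  have hh0 : 0 < 0.06 * ε₁ / L := by positivity
  have hle : q * h ^ 2 ≤ 1 := by
    have : h ^ 2 ≤ 1 := pow_le_one₀ (by linarith) hh1
    nlinarith
  have hq0 : 0 ≤ q := by rw [hq]; positivity
  calc (1 - q * h ^ 2) ^ K ≤ Real.exp (-(q * h ^ 2)) ^ K :=
        pow_le_pow_left₀ (by linarith) (Real.one_sub_le_exp_neg _) K
    _ = Real.exp (-(K * (q * h ^ 2))) := by rw [← Real.exp_nat_mul]; ring_nf
    _ ≤ _ := by
      rw [Real.exp_le_exp, neg_le_neg_iff]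
      calc 0.000129 * (ε₂ * ε₁ ^ 2 * L ^ 2) ≤ 0.0001296 * (ε₂ * ε₁ ^ 2 * L ^ 2) := by
            gcongr; norm_num
        _ = L ^ 4 * (q * (0.06 * ε₁ / L) ^ 2) := by rw [hq]; field_simp; norm_num
        _ ≤ K * (q * h ^ 2) := by gcongr

end Estimates

section Main

lemma eventually_natCast_log_large {ε₁ ε₂ : ℝ} (hε₁ : 0 < ε₁) (hε₂ : 0 < ε₂) :
    ∀ᶠ n : ℕ in atTop, 2 ≤ n ∧ 1 ≤ Real.log n ∧ 40000 * Real.log n ^ 9 ≤ n ∧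
      50 * Real.log n ^ 4 ≤ ε₂ * n ∧ Real.log n ≤ 0.003 * ε₁ * n ∧
      0.068 * ε₁ / Real.log n ≤ 0.1 ∧ 2 ≤ 0.0001 * (ε₂ * ε₁ ^ 2) * Real.log n := by
  have hlog : Tendsto (fun n : ℕ => Real.log n) atTop atTop :=
    Real.tendsto_log_atTop.comp tendsto_natCast_atTop_atTop
  have hpow (j : ℕ) {c : ℝ} (hc : 0 < c) : ∀ᶠ n : ℕ in atTop, Real.log n ^ j ≤ c * n := by
    have h := (Real.isLittleO_pow_log_id_atTop (n := j)).comp_tendsto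
      tendsto_natCast_atTop_atTop (k := (fun n : ℕ => (n : ℝ)))
    filter_upwards [h.bound hc] with n hn
    simp only [Function.comp_apply, id, Real.norm_eq_abs, Nat.abs_cast] at hn
    exact (le_abs_self _).trans hn
  filter_upwards [eventually_ge_atTop 2, hlog.eventually_ge_atTop 1,
    hpow 9 (c := 1 / 40000) (by norm_num), hpow 4 (c := ε₂ / 50) (by positivity),
    hpow 1 (c := 0.003 * ε₁) (by positivity), hlog.eventually_ge_atTop (0.68 * ε₁),
    hlog.eventually_ge_atTop (2 / (0.0001 * (ε₂ * ε₁ ^ 2)))] with n h1 h2 h3 h4 h5 h6 h7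
  refine ⟨h1, h2, by linarith, by linarith, by simpa using h5, ?_, ?_⟩
  · rw [div_le_iff₀ (by linarith)]
    linarith
  · rw [div_le_iff₀ (by positivity)] at h7
    linarith

lemma edge_density_bounds {n L p lam : ℝ} {K : ℕ} (hn : 0 < n) (hL : 1 ≤ L)
    (hLn : 40000 * L ^ 9 ≤ n) (hlam : lambdaC < lam) (hK0 : 1 ≤ K) (hK : (K : ℝ) ≤ 2 * L ^ 4)
    (hp1 : lam / Real.sqrt n ≤ p) (hp2 : p ≤ 5 * Real.sqrt L / Real.sqrt n) :
    0 < p ∧ 0.449 ≤ n * p ^ 2 ∧ 2 * K * p ≤ 0.1 ∧ p ≤ 0.1 := by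
  obtain ⟨hlam0, hlam2⟩ := le_sq_of_lambdaC_lt hlam
  have hsn : 0 < Real.sqrt n := Real.sqrt_pos.2 hn
  have hp0 : 0 < p := lt_of_lt_of_le (by positivity) hp1
  have hnp : 0.449 ≤ n * p ^ 2 := by
    calc 0.449 ≤ lam ^ 2 := hlam2
      _ = n * (lam / Real.sqrt n) ^ 2 := by
        rw [div_pow, Real.sq_sqrt hn.le]; field_simp
      _ ≤ n * p ^ 2 := by gcongr
  have hp2' : p ^ 2 ≤ 25 * L / n := by
    calc p ^ 2 ≤ (5 * Real.sqrt L / Real.sqrt n) ^ 2 := by gcongr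
      _ = 25 * L / n := by
        rw [div_pow, mul_pow, Real.sq_sqrt hn.le, Real.sq_sqrt (by linarith)]; norm_num
  have hKp : 2 * K * p ≤ 0.1 := by
    refine le_of_sq_le_sq ?_ (by norm_num)
    calc (2 * K * p) ^ 2 = 4 * (K : ℝ) ^ 2 * p ^ 2 := by ring
      _ ≤ 4 * (2 * L ^ 4) ^ 2 * (25 * L / n) := by gcongr
      _ = 400 * L ^ 9 / n := by ring
      _ ≤ 0.1 ^ 2 := by
        rw [div_le_iff₀ hn]
        linarith
  refine ⟨hp0, hnp, hKp, ?_⟩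
  have : (1 : ℝ) ≤ K := by exact_mod_cast hK0
  nlinarith

lemma le_half_floor {n ε : ℝ} {w : ℕ} (hL : 1 ≤ Real.log n)
    (hLn : Real.log n ≤ 0.003 * ε * n)
    (hw : w = ⌊ε * n / (2 * Real.logb 2 n)⌋₊) : 0.17 * ε * n / Real.log n ≤ ((w / 2 : ℕ) : ℝ) := by
  set L := Real.log n with hLdef
  have hL0 : 0 < L := by linarith
  have h1 : ε * n / (2 * Real.logb 2 n) = Real.log 2 / 2 * (ε * n / L) := by
    have := Real.log_pos one_lt_two
    rw [Real.logb, ← hLdef]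
    field_simp
  have hlog2 := Real.log_two_gt_d9
  have hx : 1 ≤ 0.003 * (ε * n / L) := by
    rw [mul_div_assoc', le_div_iff₀ hL0]
    linarith
  have h2 : ε * n / (2 * Real.logb 2 n) < w + 1 := by
    rw [hw]
    exact Nat.lt_floor_add_one _
  have h3 : (w : ℝ) ≤ 2 * ((w / 2 : ℕ) : ℝ) + 1 := by
    have : w ≤ 2 * (w / 2) + 1 := by omega
    exact_mod_cast this
  rw [h1] at h2
  have h4 : 0.17 * ε * n / L = 0.17 * (ε * n / L) := by ring
  rw [h4]
  nlinarith

lemma card_sym2_fin_le (m : ℕ) : Fintype.card (Sym2 (Fin m)) ≤ m ^ 2 := by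
  calc Fintype.card (Sym2 (Fin m)) ≤ Fintype.card (Fin m × Fin m) :=
        Fintype.card_le_of_surjective (fun x : Fin m × Fin m => s(x.1, x.2)) (by
          intro e
          induction e with
          | h x y => exact ⟨(x, y), rfl⟩)
    _ = m ^ 2 := by simp [sq]

theorem sprinkling_not_merge_le_exp {lam ε₁ ε₂ M p : ℝ} {n m w : ℕ} {H : SimpleGraph (Fin m)}
    (hlam : lambdaC < lam) (hε₁ : 0 < ε₁) (hε₂ : 0 < ε₂) (hε₂1 : ε₂ ≤ 1)
    (hn : 2 ≤ n) (hL : 1 ≤ Real.log n) (hLn : 40000 * Real.log n ^ 9 ≤ n)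
    (hLn4 : 50 * Real.log n ^ 4 ≤ ε₂ * n) (hLn1 : Real.log n ≤ 0.003 * ε₁ * n)
    (hz : 0.068 * ε₁ / Real.log n ≤ 0.1) (hm : (m : ℝ) ≤ n)
    (hw : w = ⌊ε₁ * (n : ℝ) / (2 * Real.logb 2 n)⌋₊)
    (hM1 : Real.log n ^ 4 ≤ M) (hM2 : M ≤ ε₂ / 4 * (n : ℝ) ^ 2)
    (hp1 : lam / Real.sqrt n ≤ p) (hp2 : p ≤ 5 * Real.sqrt (Real.log n) / Real.sqrt n)
    {C D : Set (Sym2 (Fin m))} (hC : ∀ e ∈ C, IsNonEdge H e) (hD : ∀ e ∈ D, IsNonEdge H e)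
    (hCM : M ≤ (C.ncard : ℝ)) (hC2M : (C.ncard : ℝ) < 2 * M)
    (hDn : ε₂ * (n : ℝ) ^ 2 ≤ (D.ncard : ℝ)) :
    (sprinkleMeasure m w p).real {ω | ¬ ∃ f ∈ C, ∃ g ∈ D, g ∉ C ∧
        (squareGraph (sprinkleGraph m w H ω)).Reachable (f.map .inl) (g.map .inl)} ≤
      Real.exp (-(0.000129 * (ε₂ * ε₁ ^ 2 * Real.log n ^ 2))) := by
  set L := Real.log n with hLdef
  set K := ⌈L ^ 4⌉₊ with hKdef
  set b := ⌈0.4 * ε₂ * (n : ℝ) ^ 2⌉₊ with hbdef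
  have hL4 : 1 ≤ L ^ 4 := one_le_pow₀ hL
  have hn0 : (0 : ℝ) < n := by positivity
  have hn1 : (1 : ℝ) ≤ n := by exact_mod_cast (by omega : 1 ≤ n)
  have hKL : L ^ 4 ≤ (K : ℝ) := Nat.le_ceil _
  have hK1 : 1 ≤ K := Nat.one_le_ceil_iff.2 (by linarith)
  have hK2 : (K : ℝ) ≤ 2 * L ^ 4 := by
    linarith [Nat.ceil_lt_add_one (by positivity : 0 ≤ L ^ 4)]
  have hKC : K ≤ C.ncard := Nat.ceil_le.2 (hM1.trans hCM)
  have hb : 0.4 * ε₂ * (n : ℝ) ^ 2 ≤ b := Nat.le_ceil _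
  have hbub : (b : ℝ) < 0.4 * ε₂ * (n : ℝ) ^ 2 + 1 := Nat.ceil_lt_add_one (by positivity)
  obtain ⟨hp0, hnp, hKp, hp01⟩ := edge_density_bounds hn0 hL hLn hlam hK1 hK2 hp1 hp2
  have hbD : b + C.ncard + 2 * K * m ≤ D.ncard := by
    have hKm : 2 * (K : ℝ) * m ≤ 4 * L ^ 4 * n := by
      calc 2 * (K : ℝ) * m ≤ 2 * (2 * L ^ 4) * n := by gcongr
        _ = 4 * L ^ 4 * n := by ring
    have hLn' : 50 * L ^ 4 * n ≤ ε₂ * (n : ℝ) ^ 2 := by nlinarith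
    have hone : 1 ≤ L ^ 4 * n := one_le_mul_of_one_le_of_one_le hL4 hn1
    have : (b : ℝ) + C.ncard + 2 * K * m ≤ D.ncard := by linarith
    exact_mod_cast this
  have hk := le_half_floor hL hLn1 hw
  have hmerge := sprinkleMeasure_not_merge_le (w := w) (k := w / 2) hp0.le (by linarith)
    (by omega) hC hD hKC hbD (q := 0.036 * ε₂) (by positivity)
    (link_bound hn0 m.cast_nonneg hm hε₂ hε₂1 hb hnp hp01)
  refine hmerge.trans (one_sub_pow_le_exp (by linarith) hKL hε₁ hε₂ hε₂1 rfl
    (hit_bound hn0 hp0.le hnp (by linarith) hKp (by linarith) hε₁ hk hz) ?_)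
  have hρ : p ^ 2 * (1 - p) ^ (2 * K) ≤ 1 :=
    mul_le_one₀ (pow_le_one₀ hp0.le (by linarith)) (pow_nonneg (by linarith) _)
      (pow_le_one₀ (by linarith) (by linarith))
  linarith [pow_nonneg (sub_nonneg.2 hρ) (w / 2)]

end Main

/-- **Sprinkling step.**  Fix `λ > λ_c` and `ε₁, ε₂ > 0`, and let
`λ n^{-1/2} ≤ p(n) ≤ 5 n^{-1/2}√(log n)`.  Let `H` be a fixed graph on `m` vertices,
`n/2 ≤ m ≤ n`, such that at least `ε₂ n²` non-edges of `H` lie in square-components of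
`□(H)` of order at least `M`, where `(log n)⁴ ≤ M ≤ (ε₂/4) n²`.  Sprinkle a set `W` of
`⌊ε₁ n/(2 log₂ n)⌋` new vertices, each pair meeting `W` being an edge independently
with probability `p`.  Then, for all large `n`, with probability at least
`1 - 2 exp(-ε₂ ε₁² (log n)²/2¹⁶)` at least `ε₂ n²` non-edges of the resulting graph lie
in square-components of order at least `2M`. -/
theorem sprinkling_step
    (lam ε₁ ε₂ : ℝ) (hlam : lambdaC < lam) (hε₁ : 0 < ε₁) (hε₂ : 0 < ε₂) :
    ∀ᶠ n : ℕ in atTop,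
      ∀ (m w : ℕ) (M p : ℝ) (H : SimpleGraph (Fin m)),
        (n : ℝ) / 2 ≤ (m : ℝ) → (m : ℝ) ≤ (n : ℝ) →
        w = ⌊ε₁ * (n : ℝ) / (2 * Real.logb 2 n)⌋₊ →
        Real.log n ^ 4 ≤ M → M ≤ ε₂ / 4 * (n : ℝ) ^ 2 →
        lam / Real.sqrt n ≤ p → p ≤ 5 * Real.sqrt (Real.log n) / Real.sqrt n →
        ε₂ * (n : ℝ) ^ 2 ≤
          (Set.ncard {e : Sym2 (Fin m) |
            IsNonEdge H e ∧ M ≤ ((squareComponent H e).ncard : ℝ)} : ℝ) →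
        ENNReal.ofReal (1 - 2 * Real.exp (-(ε₂ * ε₁ ^ 2 * Real.log n ^ 2 / 2 ^ 16))) ≤
          sprinkleMeasure m w p
            {ω | ε₂ * (n : ℝ) ^ 2 ≤
              (Set.ncard {e : Sym2 (Fin m ⊕ Fin w) |
                IsNonEdge (sprinkleGraph m w H ω) e ∧
                2 * M ≤ ((squareComponent (sprinkleGraph m w H ω) e).ncard : ℝ)} : ℝ)} := by
  filter_upwards [eventually_natCast_log_large hε₁ hε₂] with n hn m w M p H _ hm hw hM1 hM2 hp1
    hp2 hbig
  obtain ⟨hn2, hL, hLn, hLn4, hLn1, hz, hX⟩ := hn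
  set D : Set (Sym2 (Fin m)) :=
    {e | IsNonEdge H e ∧ M ≤ ((squareComponent H e).ncard : ℝ)}
  set X := ε₂ * ε₁ ^ 2 * Real.log n ^ 2 with hXdef
  have hn0 : (0 : ℝ) < n := by positivity
  have hcard : (Fintype.card (Sym2 (Fin m)) : ℝ) ≤ (n : ℝ) ^ 2 := by
    calc (Fintype.card (Sym2 (Fin m)) : ℝ) ≤ (m : ℝ) ^ 2 := by exact_mod_cast card_sym2_fin_le m
      _ ≤ (n : ℝ) ^ 2 := by gcongr
  have hε₂1 : ε₂ ≤ 1 := by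
    have h1 : (D.ncard : ℝ) ≤ Fintype.card (Sym2 (Fin m)) := by
      rw [← Nat.card_eq_fintype_card]
      exact_mod_cast Set.ncard_le_card D
    have h2 : ε₂ * (n : ℝ) ^ 2 ≤ 1 * (n : ℝ) ^ 2 := by linarith
    exact le_of_mul_le_mul_right h2 (by positivity)
  obtain ⟨hp0, -, -, hp01⟩ := edge_density_bounds (K := 1) hn0 hL hLn hlam le_rfl
    (by push_cast; linarith [one_le_pow₀ hL (n := 4)]) hp1 hp2
  have := isProbabilityMeasure_bernoulliBool hp0.le (by linarith : p ≤ 1)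
  have : IsProbabilityMeasure (sprinkleMeasure m w p) := by
    unfold sprinkleMeasure
    infer_instance
  set G : Set (Sym2 (Fin m ⊕ Fin w) → Bool) := {ω | ε₂ * (n : ℝ) ^ 2 ≤
    (Set.ncard {e : Sym2 (Fin m ⊕ Fin w) | IsNonEdge (sprinkleGraph m w H ω) e ∧
      2 * M ≤ ((squareComponent (sprinkleGraph m w H ω) e).ncard : ℝ)} : ℝ)}
  set B : Sym2 (Fin m) → Set (Sym2 (Fin m ⊕ Fin w) → Bool) := fun e =>
    {ω | ¬ ∃ f ∈ squareComponent H e, ∃ g ∈ D, g ∉ squareComponent H e ∧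
      (squareGraph (sprinkleGraph m w H ω)).Reachable (f.map .inl) (g.map .inl)}
  classical
  set S : Finset (Sym2 (Fin m)) := {e | IsNonEdge H e ∧ M ≤ ((squareComponent H e).ncard : ℝ) ∧
    ((squareComponent H e).ncard : ℝ) < 2 * M} with hS
  have hsub : Gᶜ ⊆ ⋃ e ∈ S, B e := by
    intro ω hω
    by_contra hcon
    simp only [Set.mem_iUnion, not_exists] at hcon
    refine hω (hbig.trans ?_)
    exact_mod_cast ncard_big_le_of_merge fun e he h1 h2 =>
      not_not.1 (hcon e (by simp [hS, he, h1, h2]))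
  have hBe : ∀ e ∈ S, (sprinkleMeasure m w p).real (B e) ≤ Real.exp (-(0.000129 * X)) := by
    intro e he
    simp only [hS, Finset.mem_filter, Finset.mem_univ, true_and] at he
    exact sprinkling_not_merge_le_exp hlam hε₁ hε₂ hε₂1 hn2 hL hLn hLn4 hLn1 hz hm hw hM1 hM2
      hp1 hp2 (fun f hf => isNonEdge_of_squareGraph_reachable he.1 hf) (fun f hf => hf.1)
      he.2.1 he.2.2 hbig
  have hGc : (sprinkleMeasure m w p).real Gᶜ ≤ 2 * Real.exp (-(X / 2 ^ 16)) := by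
    calc (sprinkleMeasure m w p).real Gᶜ
        ≤ (sprinkleMeasure m w p).real (⋃ e ∈ S, B e) := measureReal_mono hsub (measure_ne_top _ _)
      _ ≤ ∑ e ∈ S, (sprinkleMeasure m w p).real (B e) := measureReal_biUnion_finset_le _ _
      _ ≤ S.card * Real.exp (-(0.000129 * X)) := by
        rw [← nsmul_eq_mul]
        exact Finset.sum_le_card_nsmul _ _ _ hBe
      _ ≤ (n : ℝ) ^ 2 * Real.exp (-(0.000129 * X)) := by
        gcongr
        exact le_trans (by exact_mod_cast S.card_le_univ) hcard
      _ = Real.exp (2 * Real.log n + -(0.000129 * X)) := by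
        rw [Real.exp_add, mul_comm 2 (Real.log n), Real.exp_mul, Real.exp_log hn0]
        norm_cast
      _ ≤ Real.exp (-(X / 2 ^ 16)) := by
        rw [Real.exp_le_exp]
        have h1 : 2 * Real.log n ≤ 0.0001 * X := by
          rw [hXdef]
          nlinarith
        have h2 : 0 ≤ X := by positivity
        linarith
      _ ≤ 2 * Real.exp (-(X / 2 ^ 16)) := by linarith [Real.exp_pos (-(X / 2 ^ 16))]
  rw [probReal_compl_eq_one_sub .of_discrete] at hGc
  exact ENNReal.ofReal_le_of_le_toReal (by rw [← Measure.real]; linarith)
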